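/- arXiv:1601.07667 — 17 statements merged into one kernel-verified Lean document; each statement's English description precedes it below -/
import Mathlib

section
/- Let (Q,+) be a group with neutral element 0, let α and β be permutations of Q with α(0)=0 and β(0)=0, let a ∈ Q, and define the binary operation x·y = α(x) + a + β(y). Then the operation (·) is commutative (i.e., x·y = y·x for all x,y ∈ Q) if and only if the group (Q,+) is abelian and α = β. -/
/-- Criterion for commutativity of a group isotope in canonical decomposition:
`x·y = α x + a + β y` is commutative iff `(Q,+)` is abelian and `α = β`. -/
theorem group_isotope_commutative_iff {Q : Type*} [AddGroup Q]
    (α β : Equiv.Perm Q) (hα : α 0 = 0) (hβ : β 0 = 0) (a : Q)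
    (mul : Q → Q → Q) (hmul : ∀ x y, mul x y = α x + a + β y) :
    (∀ x y, mul x y = mul y x) ↔ ((∀ x y : Q, x + y = y + x) ∧ α = β) := by
  constructor
  · intro h
    have h0 : ∀ x, α x + a = a + β x := by
      intro x
      have := h x 0
      simpa [hmul, hα, hβ] using this
    have hc : ∀ x y : Q, x + y = y + x := by
      intro x y
      have := h (β.symm x) (β.symm y)
      rw [hmul, hmul, h0, h0, Equiv.apply_symm_apply, Equiv.apply_symm_apply,
        add_assoc, add_assoc] at this
      exact add_left_cancel this
    refine ⟨hc, ?_⟩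
    ext x
    have := h0 x
    rw [hc a] at this
    exact add_right_cancel this
  · rintro ⟨hc, rfl⟩ x y
    rw [hmul, hmul, hc (α x) a, hc (α y) a, add_assoc, add_assoc, hc (α x)]
end

section
/- Let (Q,+) be a group with neutral element 0, let α and β be permutations of Q with α(0)=0 and β(0)=0, let a ∈ Q, and define x·y = α(x) + a + β(y). Then (·) is left symmetric (i.e., x·(x·y) = y for all x,y ∈ Q) if and only if (Q,+) is abelian and β(y) = -y for all y ∈ Q. -/
/-- Criterion for left symmetry of a group isotope in canonical decomposition:
`x·y = α x + a + β y` satisfies `x·(x·y) = y` iff `(Q,+)` is abelian and `β = -id`. -/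
theorem group_isotope_left_symmetric_iff {Q : Type*} [AddGroup Q]
    (α β : Equiv.Perm Q) (hα : α 0 = 0) (hβ : β 0 = 0) (a : Q)
    (mul : Q → Q → Q) (hmul : ∀ x y, mul x y = α x + a + β y) :
    (∀ x y, mul x (mul x y) = y) ↔
      ((∀ x y : Q, x + y = y + x) ∧ (∀ y : Q, β y = -y)) := by
  constructor
  · intro h
    have key : ∀ u y, u + β (u + β y) = y := by
      intro u y
      have := h (α.symm (u - a)) y
      simpa [hmul] using this
    have hb : ∀ u, β u = -u := by
      intro u
      have := key u 0
      rw [hβ, add_zero] at this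
      exact (neg_eq_of_add_eq_zero_right this).symm
    refine ⟨?_, hb⟩
    intro x y
    have := key x y
    rw [hb, hb, neg_add_rev, neg_neg, ← add_assoc] at this
    exact add_neg_eq_iff_eq_add.mp this
  · rintro ⟨hc, hb⟩ x y
    rw [hmul, hmul, hb, hb, neg_add_rev, neg_neg, ← add_assoc, hc _ y, add_neg_cancel_right]
end

section
/- Let (Q,+) be a group with neutral element 0, let α and β be permutations of Q with α(0)=0 and β(0)=0, let a ∈ Q, and define x·y = α(x) + a + β(y). Then (·) is right symmetric (i.e., (x·y)·y = x for all x,y ∈ Q) if and only if (Q,+) is abelian and α(x) = -x for all x ∈ Q. -/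
/-- Criterion for right symmetry of a group isotope in canonical decomposition:
`x·y = α x + a + β y` satisfies `(x·y)·y = x` iff `(Q,+)` is abelian and `α = -id`. -/
theorem group_isotope_right_symmetric_iff {Q : Type*} [AddGroup Q]
    (α β : Equiv.Perm Q) (hα : α 0 = 0) (hβ : β 0 = 0) (a : Q)
    (mul : Q → Q → Q) (hmul : ∀ x y, mul x y = α x + a + β y) :
    (∀ x y, mul (mul x y) y = x) ↔
      ((∀ x y : Q, x + y = y + x) ∧ (∀ x : Q, α x = -x)) := by
  constructor
  · intro h
    have key : ∀ x z, α (α x + z) + z = x := by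
      intro x z
      have h1 := h x (β.symm (-a + z))
      simp only [hmul, Equiv.apply_symm_apply] at h1
      simpa [add_assoc] using h1
    have hneg : ∀ x, α x = -x := by
      intro z
      have h1 := key 0 z
      rw [hα, zero_add] at h1
      exact eq_neg_of_add_eq_zero_left h1
    refine ⟨?_, hneg⟩
    intro x y
    have h1 := key x y
    rw [hneg, hneg, neg_add_rev, neg_neg] at h1
    have h2 : y + (-y + x + y) = y + x := by rw [h1]
    rw [← h2]
    simp [← add_assoc]
  · rintro ⟨hc, hneg⟩ x y
    simp only [hmul, hneg]
    rw [add_assoc (-x), add_assoc, neg_add_rev, neg_neg, add_assoc, hc x]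
    simp [add_assoc]
end

section
/- Let (Q,+) be a group with neutral element 0, let α and β be permutations of Q with α(0)=0 and β(0)=0, let a ∈ Q, and define x·y = α(x) + a + β(y). Then (·) is totally symmetric (i.e., it satisfies both x·y = y·x and (x·y)·y = x for all x,y ∈ Q) if and only if (Q,+) is abelian and α(x) = -x and β(x) = -x for all x ∈ Q. -/
/-- Criterion for total symmetry of a group isotope in canonical decomposition:
`x·y = α x + a + β y` is commutative and right symmetric iff `(Q,+)` is abelian
and `α = β = -id`. -/
theorem group_isotope_totally_symmetric_iff {Q : Type*} [AddGroup Q]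
    (α β : Equiv.Perm Q) (hα : α 0 = 0) (hβ : β 0 = 0) (a : Q)
    (mul : Q → Q → Q) (hmul : ∀ x y, mul x y = α x + a + β y) :
    ((∀ x y, mul x y = mul y x) ∧ (∀ x y, mul (mul x y) y = x)) ↔
      ((∀ x y : Q, x + y = y + x) ∧ (∀ x : Q, α x = -x) ∧ (∀ x : Q, β x = -x)) := by
  constructor
  · rintro ⟨hc, hr⟩
    have h1 : ∀ x, α x + a = a + β x := by
      intro x
      have := hc x 0
      rw [hmul, hmul, hα, hβ] at this
      simpa using this
    have hab : ∀ x y : Q, x + y = y + x := by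
      intro x y
      obtain ⟨u, rfl⟩ := α.surjective x
      obtain ⟨v, rfl⟩ := α.surjective y
      have := hc u v
      rw [hmul, hmul, add_assoc, add_assoc, ← h1, ← h1, ← add_assoc, ← add_assoc] at this
      exact add_right_cancel this
    have hα' : ∀ x, α x = -x := by
      intro x
      obtain ⟨y, hy⟩ := β.surjective (-(α x + a))
      have h0 : mul x y = 0 := by rw [hmul, hy, add_neg_cancel]
      have := hr x y
      rw [h0, hmul, hα, hy, zero_add, neg_add_rev, add_neg_cancel_left] at this
      rw [← neg_neg (α x), this]
    refine ⟨hab, hα', fun x => ?_⟩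
    have := h1 x
    rw [hab a] at this
    rw [← add_right_cancel this, hα']
  · rintro ⟨hab, h1, h2⟩
    constructor
    · intro x y
      rw [hmul, hmul, h1, h1, h2, h2]
      rw [add_assoc, hab, hab a]
    · intro x y
      rw [hmul, hmul, h1, h1, h2, neg_add_rev, neg_add_rev, neg_neg, neg_neg]
      rw [hab (-a) x, ← add_assoc, neg_add_cancel_right, hab y x, add_neg_cancel_right]
end

section
/- Let (Q,+) be a group with neutral element 0, let α and β be permutations of Q with α(0)=0 and β(0)=0, let a ∈ Q, and define x·y = α(x) + a + β(y). Then (·) is semi-symmetric (i.e., x·(y·x) = y for all x,y ∈ Q) if and only if the following four conditions hold: α is an anti-automorphism of (Q,+) (α(x+y) = α(y)+α(x) for all x,y); β = α⁻¹; α(α(α(x))) = a + (-x) + (-a) for all x ∈ Q (i.e., α³ = -I_a⁻¹ where I_a(x) = -a+x+a); and α(a) = -a. -/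
/-- Criterion for semi-symmetry of a group isotope in canonical decomposition:
`x·y = α x + a + β y` satisfies `x·(y·x) = y` iff `α` is an anti-automorphism,
`β = α⁻¹`, `α³ = -I_a⁻¹` (i.e. `α(α(α x)) = a + (-x) + (-a)`), and `α a = -a`. -/
theorem group_isotope_semi_symmetric_iff {Q : Type*} [AddGroup Q]
    (α β : Equiv.Perm Q) (hα : α 0 = 0) (hβ : β 0 = 0) (a : Q)
    (mul : Q → Q → Q) (hmul : ∀ x y, mul x y = α x + a + β y) :
    (∀ x y, mul x (mul y x) = y) ↔
      ((∀ x y : Q, α (x + y) = α y + α x) ∧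
       β = α⁻¹ ∧
       (∀ x : Q, α (α (α x)) = a + (-x) + (-a)) ∧
       α a = -a) := by
  constructor
  · intro h
    have h1 : ∀ x y, α x + a + β (α y + a + β x) = y := by
      intro x y
      have := h x y
      rwa [hmul, hmul] at this
    have h2 : ∀ y, β (α y + a) = -a + y := by
      intro y
      have := h1 0 y
      rw [hα, hβ, zero_add, add_zero] at this
      rw [eq_neg_add_iff_add_eq, this]
    have h3 : ∀ x y, β (α y + a + β x) = -a + -α x + y := by
      intro x y
      rw [← neg_add_rev, eq_neg_add_iff_add_eq, h1]
    have h4 : ∀ x v, β (v + β x) = (-a + -α x + a) + β v := by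
      intro x v
      have e : α (α.symm (v - a)) + a = v := by simp
      have p := h3 x (α.symm (v - a))
      have q := h2 (α.symm (v - a))
      rw [e] at p q
      rw [p, q]
      simp [add_assoc]
    have h5 : ∀ x, β (β x) = -a + -α x + a := by
      intro x
      have := h4 x 0
      rwa [zero_add, hβ, add_zero] at this
    have h6 : ∀ v w, β (v + w) = β w + β v := by
      intro v w
      have e := h4 (β.symm w) v
      rw [← h5] at e
      simpa using e
    have h7 : β a = -a := by
      have := h2 0
      rwa [hα, zero_add, add_zero] at this
    have h8 : ∀ y, β (α y) = y := by
      intro y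
      have := h2 y
      rw [h6, h7] at this
      exact add_left_cancel this
    have h9 : ∀ y, α (β y) = y := fun y => β.injective (h8 _)
    refine ⟨?_, ?_, ?_, ?_⟩
    · intro x y
      apply β.injective
      rw [h8, h6, h8, h8]
    · ext y
      apply α.injective
      rw [h9]; simp
    · intro x
      have := h5 (α (α x))
      rw [h8, h8] at this
      generalize α (α (α x)) = t at this
      rw [this]
      simp [add_assoc]
    · apply β.injective
      rw [h8, ← h7]
      have e : β (-a) + β a = 0 := by rw [← h6, add_neg_cancel, hβ]
      rw [h7] at e
      rw [h7]
      exact (add_neg_eq_zero.mp e).symm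
  · rintro ⟨h1, rfl, h3, h4⟩ x y
    rw [hmul, hmul]
    obtain ⟨z, rfl⟩ : ∃ z, α (α z) = x := ⟨α.symm (α.symm x), by simp⟩
    have e : α (z + -a + y) = α y + a + α z := by
      have e1 : α (-a) = a := by
        have e : α (-a) + α a = 0 := by rw [← h1, add_neg_cancel, hα]
        rw [h4] at e
        exact add_neg_eq_zero.mp e
      rw [h1, h1, e1, add_assoc]
    have e2 : (α⁻¹ : Equiv.Perm Q) (α (α z)) = α z := by simp
    rw [e2, ← e]
    have e3 : (α⁻¹ : Equiv.Perm Q) (α (z + -a + y)) = z + -a + y := by simp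
    rw [e3, h3]
    simp [add_assoc]
end

section
/- Let (Q,+) be a group with neutral element 0, let α and β be permutations of Q with α(0)=0 and β(0)=0, let a ∈ Q, and define x·y = α(x) + a + β(y). Then (·) is asymmetric (i.e., it satisfies none of the identities x·y = y·x, x·(x·y) = y, (x·y)·y = x, x·(y·x) = y) if and only if: [(Q,+) is not abelian, or (α ≠ -id and β ≠ -id and α ≠ β)], and at least one of the following holds: α is not an anti-automorphism of (Q,+), or β ≠ α⁻¹, or α³ ≠ -I_a⁻¹ (i.e., it is not the case that α(α(α(x))) = a + (-x) + (-a) for all x), or α(a) ≠ -a. -/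
lemma gi_comm {Q : Type*} [AddGroup Q] (α β : Equiv.Perm Q) (hα : α 0 = 0) (hβ : β 0 = 0) (a : Q) :
    (∀ x y, α x + a + β y = α y + a + β x) ↔ (∀ x y : Q, x + y = y + x) ∧ α = β := by
  constructor
  · intro h
    have h0 : ∀ x, α x + a = a + β x := fun x => by simpa [hα, hβ] using h x 0
    have hc : ∀ x y : Q, x + y = y + x := by
      intro x y
      have := h (α.symm x) (α.symm y)
      rw [add_assoc, ← h0, add_assoc (α (α.symm y)), ← h0, ← add_assoc, ← add_assoc] at this
      simpa using this
    refine ⟨hc, Equiv.ext fun x => ?_⟩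
    have := h0 x
    rw [hc a] at this
    exact add_right_cancel this
  · rintro ⟨hc, rfl⟩ x y
    rw [hc (α x) a, hc (α y) a, add_assoc, add_assoc, hc (α x)]

lemma gi_left {Q : Type*} [AddGroup Q] (α β : Equiv.Perm Q) (hβ : β 0 = 0) (a : Q) :
    (∀ x y, α x + a + β (α x + a + β y) = y) ↔ (∀ x y : Q, x + y = y + x) ∧ ∀ x, β x = -x := by
  constructor
  · intro h
    have h1 : ∀ z y, z + β (z + β y) = y := fun z y => by
      simpa using h (α.symm (z - a)) y
    have hb : ∀ z, β z = -z := fun z => by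
      have := h1 z 0
      rw [hβ, add_zero] at this
      exact (neg_eq_of_add_eq_zero_right this).symm
    refine ⟨fun x y => ?_, hb⟩
    have := h1 x y
    rw [hb, hb, neg_add_rev, neg_neg, ← add_assoc, add_neg_eq_iff_eq_add] at this
    exact this
  · rintro ⟨hc, hb⟩ x y
    rw [hb, hb, hc _ (-y), neg_add_rev, neg_neg, hc _ y, hc, add_assoc, neg_add_cancel, add_zero]

lemma gi_right {Q : Type*} [AddGroup Q] (α β : Equiv.Perm Q) (hα : α 0 = 0) (a : Q) :
    (∀ x y, α (α x + a + β y) + a + β y = x) ↔ (∀ x y : Q, x + y = y + x) ∧ ∀ x, α x = -x := by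
  constructor
  · intro h
    have h1 : ∀ x w, α (α x + w) + w = x := fun x w => by
      simpa [add_assoc] using h x (β.symm (-a + w))
    have hb : ∀ z, α z = -z := fun z => by
      have := h1 0 z
      rw [hα, zero_add] at this
      exact eq_neg_of_add_eq_zero_left this
    refine ⟨fun x y => ?_, hb⟩
    have := h1 x y
    rw [hb, hb, neg_add_rev, neg_neg, add_assoc, neg_add_eq_iff_eq_add] at this
    exact this
  · rintro ⟨hc, hb⟩ x y
    rw [hb, hb, add_assoc, add_assoc, hc (-x), neg_add_rev, neg_neg, add_assoc, neg_add_cancel,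
      add_zero]

lemma gi_semi {Q : Type*} [AddGroup Q] (α β : Equiv.Perm Q) (hα : α 0 = 0) (hβ : β 0 = 0) (a : Q) :
    (∀ x y, α x + a + β (α y + a + β x) = y) ↔
      (∀ x y : Q, α (x + y) = α y + α x) ∧ β = α⁻¹ ∧
      (∀ x : Q, α (α (α x)) = a + (-x) + (-a)) ∧ α a = -a := by
  constructor
  · intro h
    have h0 : ∀ y, a + β (α y + a) = y := fun y => by simpa [hα, hβ] using h 0 y
    have hβu : ∀ u, β u = -a + α.symm (u + -a) := fun u => by
      have := h0 (α.symm (u + -a))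
      rw [eq_neg_add_iff_add_eq]
      simpa using this
    have ha' : α.symm (-a) = a := by
      have := hβu 0
      rw [hβ, zero_add, eq_comm, neg_add_eq_zero] at this
      exact this.symm
    have ha : α a = -a := ((Equiv.symm_apply_eq α).mp ha').symm
    have h2 : ∀ x y, α (-α x + y) = α y + a + β x + -a := fun x y => by
      have := h x y
      rw [hβu (α y + a + β x)] at this
      rw [← Equiv.eq_symm_apply, neg_add_eq_iff_eq_add, eq_comm]
      simpa [add_assoc] using this
    have h3 : ∀ x, α (-α x) = a + β x + -a := fun x => by simpa [hα] using h2 x 0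
    have hanti : ∀ x y : Q, α (x + y) = α y + α x := fun x y => by
      have h4 := h2 (α.symm (-x)) y
      have h5 := h3 (α.symm (-x))
      simp only [Equiv.apply_symm_apply, neg_neg] at h4 h5
      rw [h4, h5]; simp [add_assoc]
    have hneg : ∀ x, α (-x) = -α x := fun x => by
      rw [eq_neg_iff_add_eq_zero, ← hanti, add_neg_cancel, hα]
    have hbi : ∀ x, β x = α.symm x := fun x => by
      rw [hβu, Equiv.eq_symm_apply, hanti, hneg, ha]; simp
    refine ⟨hanti, Equiv.ext hbi, fun x => ?_, ha⟩
    have h6 := h3 (α x)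
    rw [hneg, hbi, Equiv.symm_apply_apply, neg_eq_iff_eq_neg] at h6
    rw [h6]; simp [add_assoc]
  · rintro ⟨hanti, rfl, h3, ha⟩ x y
    apply α.injective
    obtain ⟨z, rfl⟩ := α.surjective x
    obtain ⟨w, rfl⟩ := α.surjective z
    have hi : ∀ x, (α⁻¹ : Equiv.Perm Q) (α x) = x := fun x => α.symm_apply_apply x
    have hi' : ∀ x, α ((α⁻¹ : Equiv.Perm Q) x) = x := fun x => α.apply_symm_apply x
    have hneg : ∀ x, α (-x) = -α x := fun x => by
      rw [eq_neg_iff_add_eq_zero, ← hanti, add_neg_cancel, hα]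
    rw [hanti, hi', h3, hi]
    simp only [hanti, hneg, ha]
    simp [add_assoc]

/-- Criterion for asymmetry of a group isotope in canonical decomposition:
`x·y = α x + a + β y` satisfies none of commutativity, left symmetry, right
symmetry and semi-symmetry iff `(Q,+)` is not abelian or
`-id ≠ α ≠ β ≠ -id`, and at least one of the following holds: `α` is not an
anti-automorphism, `β ≠ α⁻¹`, `α³ ≠ -I_a⁻¹`, `α a ≠ -a`. -/
theorem group_isotope_asymmetric_iff {Q : Type*} [AddGroup Q]
    (α β : Equiv.Perm Q) (hα : α 0 = 0) (hβ : β 0 = 0) (a : Q)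
    (mul : Q → Q → Q) (hmul : ∀ x y, mul x y = α x + a + β y) :
    ((¬ ∀ x y, mul x y = mul y x) ∧
     (¬ ∀ x y, mul x (mul x y) = y) ∧
     (¬ ∀ x y, mul (mul x y) y = x) ∧
     (¬ ∀ x y, mul x (mul y x) = y)) ↔
      (((¬ ∀ x y : Q, x + y = y + x) ∨
        ((¬ ∀ x : Q, α x = -x) ∧ (¬ ∀ x : Q, β x = -x) ∧ α ≠ β)) ∧
       ((¬ ∀ x y : Q, α (x + y) = α y + α x) ∨
        β ≠ α⁻¹ ∨
        (¬ ∀ x : Q, α (α (α x)) = a + (-x) + (-a)) ∨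
        α a ≠ -a)) := by
  have hm : mul = fun x y => α x + a + β y := by funext x y; exact hmul x y
  subst hm
  have h1 := gi_comm α β hα hβ a
  have h2 := gi_left α β hβ a
  have h3 := gi_right α β hα a
  have h4 := gi_semi α β hα hβ a
  simp only [h1, h2, h3, h4]
  simp only [ne_eq]
  generalize (∀ x y : Q, x + y = y + x) = A
  generalize (α = β) = B
  generalize (∀ x : Q, β x = -x) = C
  generalize (∀ x : Q, α x = -x) = D
  generalize (∀ x y : Q, α (x + y) = α y + α x) = E
  generalize (β = α⁻¹) = F
  generalize (∀ x : Q, α (α (α x)) = a + (-x) + (-a)) = G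
  generalize (α a = -a) = H
  clear h1 h2 h3 h4 hmul hα hβ
  by_cases A <;> by_cases B <;> by_cases C <;> by_cases D <;> simp_all <;> tauto
end

section
/- Let (Q,+) be a non-abelian group with neutral element 0, let α and β be permutations of Q with α(0)=0 and β(0)=0, let a ∈ Q, and define x·y = α(x) + a + β(y). Then (·) satisfies none of the identities x·y = y·x (commutativity), x·(x·y) = y (left symmetry), and (x·y)·y = x (right symmetry); consequently, such an isotope of a noncommutative group is either semi-symmetric or asymmetric. -/
/-- An isotope of a noncommutative group is neither commutative, nor left
symmetric, nor right symmetric; consequently it is either semi-symmetric or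
asymmetric. -/
theorem isotope_of_noncommutative_group {Q : Type*} [AddGroup Q]
    (hna : ¬ ∀ x y : Q, x + y = y + x)
    (α β : Equiv.Perm Q) (hα : α 0 = 0) (hβ : β 0 = 0) (a : Q)
    (mul : Q → Q → Q) (hmul : ∀ x y, mul x y = α x + a + β y) :
    (¬ ∀ x y, mul x y = mul y x) ∧
    (¬ ∀ x y, mul x (mul x y) = y) ∧
    (¬ ∀ x y, mul (mul x y) y = x) ∧
    ((∀ x y, mul x (mul y x) = y) ∨
      ((¬ ∀ x y, mul x y = mul y x) ∧
       (¬ ∀ x y, mul x (mul x y) = y) ∧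
       (¬ ∀ x y, mul (mul x y) y = x) ∧
       (¬ ∀ x y, mul x (mul y x) = y))) := by
  have h1 : ¬ ∀ x y, mul x y = mul y x := by
    intro h
    apply hna
    have hb : ∀ x, β x = -a + (α x + a) := by
      intro x
      have := h x 0
      simp only [hmul, hα, hβ, add_zero, zero_add] at this
      rw [this, neg_add_cancel_left]
    intro u v
    obtain ⟨x, rfl⟩ := α.surjective u
    obtain ⟨y, rfl⟩ := α.surjective v
    have := h x y
    simp only [hmul, hb, add_assoc, add_neg_cancel_left] at this
    simpa only [← add_assoc, add_left_inj] using this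
  have h2 : ¬ ∀ x y, mul x (mul x y) = y := by
    intro h
    apply hna
    have hu : ∀ u y, u + β (u + β y) = y := by
      intro u y
      obtain ⟨x, hx⟩ := α.surjective (u - a)
      have := h x y
      simpa only [hmul, hx, sub_add_cancel] using this
    have hb : ∀ u, β u = -u := by
      intro u
      have := hu u 0
      rw [hβ, add_zero] at this
      exact (neg_eq_of_add_eq_zero_right this).symm
    intro u y
    have := hu u y
    rw [hb, hb, neg_add_rev, neg_neg, ← add_assoc] at this
    exact eq_add_of_add_neg_eq this
  have h3 : ¬ ∀ x y, mul (mul x y) y = x := by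
    intro h
    apply hna
    have hu : ∀ w x, α (α x + w) + w = x := by
      intro w x
      obtain ⟨y, hy⟩ := β.surjective (-a + w)
      have := h x y
      simpa only [hmul, hy, add_assoc, add_neg_cancel_left] using this
    have hb : ∀ w, α w = -w := by
      intro w
      have := hu w 0
      rw [hα, zero_add] at this
      exact eq_neg_of_add_eq_zero_left this
    intro x w
    have := hu w x
    rw [hb, hb, neg_add_rev, neg_neg, add_assoc] at this
    exact eq_add_of_neg_add_eq this
  refine ⟨h1, h2, h3, ?_⟩
  by_cases h4 : ∀ x y, mul x (mul y x) = y
  · exact Or.inl h4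
  · exact Or.inr ⟨h1, h2, h3, h4⟩
end

section
/- Let (Q,+) be a group, let φ and ψ be automorphisms of (Q,+), let c ∈ Q, and define x·y = φ(x) + c + ψ(y). If (·) satisfies any one of: commutativity (x·y = y·x), left symmetry (x·(x·y) = y), right symmetry ((x·y)·y = x), or total symmetry (both commutativity and right symmetry), then (·) is medial, i.e., (x·y)·(u·v) = (x·u)·(y·v) holds for all x,y,u,v ∈ Q. -/
theorem medial_aux {Q : Type*} [AddGroup Q]
    (φ ψ : AddAut Q) (c : Q)
    (mul : Q → Q → Q) (hmul : ∀ x y, mul x y = φ x + c + ψ y)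
    (hc : ∀ x y : Q, x + y = y + x) (hφ : ∀ x, φ (ψ x) = ψ (φ x)) :
    ∀ x y u v, mul (mul x y) (mul u v) = mul (mul x u) (mul y v) := by
  intro x y u v
  haveI : Std.Commutative (α := Q) (· + ·) := ⟨hc⟩
  simp only [hmul, map_add, hφ]
  ac_rfl

theorem medial_of_comm {Q : Type*} [AddGroup Q]
    (φ ψ : AddAut Q) (c : Q)
    (mul : Q → Q → Q) (hmul : ∀ x y, mul x y = φ x + c + ψ y)
    (h : ∀ x y, mul x y = mul y x) :
    ∀ x y u v, mul (mul x y) (mul u v) = mul (mul x u) (mul y v) := by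
  simp only [hmul] at h
  have h0 : ∀ y, c + ψ y = φ y + c := fun y => by simpa using h 0 y
  have hc : ∀ x y : Q, x + y = y + x := by
    intro x y
    have := h (φ.symm x) (φ.symm y)
    rw [add_assoc, h0, add_assoc, h0] at this
    simp only [← add_assoc, AddEquiv.apply_symm_apply] at this
    exact add_right_cancel this
  have he : ∀ y, ψ y = φ y := fun y => by
    have := h0 y
    rw [hc (φ y)] at this
    exact add_left_cancel this
  exact medial_aux φ ψ c mul hmul hc (fun x => by simp only [he])

theorem comm_of_conj_neg {Q : Type*} [AddGroup Q] (ψ : AddAut Q) (c : Q)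
    (h : ∀ z, ψ z = c + -z + -c) : ∀ x y : Q, x + y = y + x := by
  intro x y
  have h1 := map_add ψ (-x) (-y)
  simp only [h, neg_add_rev, neg_neg] at h1
  have h2 : c + (y + x) + -c = c + (x + y) + -c := by
    rw [h1]; simp only [add_assoc, neg_add_cancel_left]
  exact (add_left_cancel (add_right_cancel h2)).symm

/-- Commutative, left symmetric, right symmetric and totally symmetric linear
isotopes of a group are medial quasigroups. -/
theorem symmetric_linear_group_isotope_is_medial {Q : Type*} [AddGroup Q]
    (φ ψ : AddAut Q) (c : Q)
    (mul : Q → Q → Q) (hmul : ∀ x y, mul x y = φ x + c + ψ y)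
    (hsym : (∀ x y, mul x y = mul y x) ∨
            (∀ x y, mul x (mul x y) = y) ∨
            (∀ x y, mul (mul x y) y = x) ∨
            ((∀ x y, mul x y = mul y x) ∧ (∀ x y, mul (mul x y) y = x))) :
    ∀ x y u v, mul (mul x y) (mul u v) = mul (mul x u) (mul y v) := by
  have neg_of : ∀ (χ : AddAut Q) (d : Q), (∀ z, χ z = d + -z + -d) →
      (∀ x y : Q, x + y = y + x) ∧ ∀ z, χ z = -z := by
    intro χ d h
    have hc := comm_of_conj_neg χ d h
    refine ⟨hc, fun z => ?_⟩
    rw [h, hc d, add_neg_cancel_right]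
  rcases hsym with h | h | h | h
  · exact medial_of_comm φ ψ c mul hmul h
  · simp only [hmul, map_add] at h
    have h00 : c + ψ c = 0 := by simpa using h 0 0
    have hψc : ψ c = -c := (neg_eq_of_add_eq_zero_right h00).symm
    have key : ∀ z, ψ z = -c + -z + -(-c) := by
      intro z
      have := h (φ.symm z) 0
      simp only [AddEquiv.apply_symm_apply, map_zero, add_zero, hψc] at this
      have h3 : (z + c) + (ψ z + -c) = 0 := by simpa only [add_assoc] using this
      have h4 := neg_eq_of_add_eq_zero_right h3
      rw [neg_add_rev] at h4
      rw [h4]; simp only [add_assoc, neg_neg, neg_add_cancel, add_zero]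
    obtain ⟨hc, hn⟩ := neg_of ψ _ key
    exact medial_aux φ ψ c mul hmul hc (fun x => by simp only [hn, map_neg])
  · simp only [hmul, map_add] at h
    have h00 : φ c + c = 0 := by simpa using h 0 0
    have hφc : φ c = -c := eq_neg_of_add_eq_zero_left h00
    have key : ∀ z, φ z = c + -z + -c := by
      intro z
      have := h 0 (ψ.symm z)
      simp only [AddEquiv.apply_symm_apply, map_zero, zero_add, hφc] at this
      have h3 : (-c + φ z) + (c + z) = 0 := by simpa only [add_assoc] using this
      have h4 := eq_neg_of_add_eq_zero_left h3
      rw [neg_add_rev] at h4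
      rw [add_assoc, ← h4, add_neg_cancel_left]
    obtain ⟨hc, hn⟩ := neg_of φ _ key
    exact medial_aux φ ψ c mul hmul hc (fun x => by simp only [hn, map_neg])
  · exact medial_of_comm φ ψ c mul hmul h.1
end

section
/- Let (Q,+) be an abelian group, let φ and ψ be automorphisms of (Q,+), let c ∈ Q, and define x·y = φ(x) + c + ψ(y) (a T-quasigroup). If (·) satisfies any one of the symmetry identities x·y = y·x, x·(x·y) = y, (x·y)·y = x, or x·(y·x) = y, then (·) is medial, i.e., (x·y)·(u·v) = (x·u)·(y·v) for all x,y,u,v ∈ Q. Equivalently, every nonmedial T-quasigroup is asymmetric. -/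
/-- A T-quasigroup (linear isotope of an abelian group) satisfying any of the
symmetry identities (commutativity, left symmetry, right symmetry or
semi-symmetry) is medial; equivalently, every nonmedial T-quasigroup is
asymmetric. -/
theorem symmetric_T_quasigroup_is_medial {Q : Type*} [AddCommGroup Q]
    (φ ψ : AddAut Q) (c : Q)
    (mul : Q → Q → Q) (hmul : ∀ x y, mul x y = φ x + c + ψ y)
    (hsym : (∀ x y, mul x y = mul y x) ∨
            (∀ x y, mul x (mul x y) = y) ∨
            (∀ x y, mul (mul x y) y = x) ∨
            (∀ x y, mul x (mul y x) = y)) :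
    ∀ x y u v, mul (mul x y) (mul u v) = mul (mul x u) (mul y v) := by
  have key : ∀ z, φ (ψ z) = ψ (φ z) := by
    simp only [hmul, map_add] at hsym
    rcases hsym with h | h | h | h
    · have e : ∀ z, φ z = ψ z := fun z => by
        have h1 := h z 0
        simp only [map_zero, add_zero, zero_add] at h1
        rw [add_comm] at h1
        exact add_left_cancel h1
      intro z
      rw [e, e]
    · have h0 := h 0 0
      simp only [map_zero, add_zero, zero_add] at h0
      have e : ∀ z, ψ z = -z := fun z => by
        obtain ⟨x, rfl⟩ := φ.surjective z
        have h1 := h x 0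
        simp only [map_zero, add_zero] at h1
        have h2 : ψ (φ x) + φ x + (c + ψ c) = 0 := by rw [← h1]; abel
        rw [h0, add_zero] at h2
        exact eq_neg_of_add_eq_zero_left h2
      intro z
      rw [e, e, map_neg]
    · have h0 := h 0 0
      simp only [map_zero, add_zero, zero_add] at h0
      have e : ∀ z, φ z = -z := fun z => by
        obtain ⟨x, rfl⟩ := ψ.surjective z
        have h1 := h 0 x
        simp only [map_zero, zero_add] at h1
        have h2 : φ (ψ x) + ψ x + (φ c + c) = 0 := by rw [← h1]; abel
        rw [h0, add_zero] at h2
        exact eq_neg_of_add_eq_zero_left h2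
      intro z
      rw [e, e, map_neg]
    · have h0 := h 0 0
      simp only [map_zero, add_zero, zero_add] at h0
      have e : ∀ z, φ z = -ψ (ψ z) := fun z => by
        have h1 := h z 0
        simp only [map_zero, zero_add] at h1
        have h2 : φ z + ψ (ψ z) + (c + ψ c) = 0 := by rw [← h1]; abel
        rw [h0, add_zero] at h2
        exact eq_neg_of_add_eq_zero_left h2
      intro z
      rw [e, e, map_neg]
  intro x y u v
  simp only [hmul, map_add, key]
  abel
end

section
/- Let (Q,+) be an abelian group with neutral element 0, let α and β be permutations of Q with α(0)=0 and β(0)=0, let a ∈ Q, and define x·y = α(x) + a + β(y). Then (·) is semi-symmetric (x·(y·x) = y for all x,y) if and only if: α is an automorphism of (Q,+), β = α⁻¹, α(α(α(x))) = -x for all x ∈ Q, and α(a) = -a. -/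
/-- Criterion for semi-symmetry of an isotope of an abelian group in canonical
decomposition: `x·y = α x + a + β y` satisfies `x·(y·x) = y` iff `α` is an
automorphism of `(Q,+)`, `β = α⁻¹`, `α³ = -id` and `α a = -a`. -/
theorem abelian_group_isotope_semi_symmetric_iff {Q : Type*} [AddCommGroup Q]
    (α β : Equiv.Perm Q) (hα : α 0 = 0) (hβ : β 0 = 0) (a : Q)
    (mul : Q → Q → Q) (hmul : ∀ x y, mul x y = α x + a + β y) :
    (∀ x y, mul x (mul y x) = y) ↔
      ((∀ x y : Q, α (x + y) = α x + α y) ∧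
       β = α⁻¹ ∧
       (∀ x : Q, α (α (α x)) = -x) ∧
       α a = -a) := by
  simp only [hmul]
  constructor
  · intro H
    have h0 : ∀ y, β (α y + a) = y - a := by
      intro y
      have h := H 0 y
      rw [hα, hβ, add_zero, zero_add] at h
      rw [eq_sub_iff_add_eq, add_comm]; exact h
    have h1 : ∀ x y, α (y - α x) = α y + β x := by
      intro x y
      obtain ⟨z, hz⟩ := α.surjective (α y + β x)
      have h := H x y
      have e : α y + a + β x = α z + a := by rw [hz]; abel
      rw [e, h0] at h
      have : z = y - α x := by rw [← h]; abel
      rw [← this, hz]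
    have h2 : ∀ x, α (-α x) = β x := by
      intro x
      have := h1 x 0
      rwa [hα, zero_add, zero_sub] at this
    have hadd : ∀ x y : Q, α (x + y) = α x + α y := by
      intro x y
      obtain ⟨z, hz⟩ := α.surjective (-y)
      have h := h1 z x
      rw [← h2, hz] at h
      simpa using h
    have hneg : ∀ x, α (-x) = -α x := by
      intro x
      have := hadd (-x) x
      rw [neg_add_cancel, hα] at this
      exact eq_neg_of_add_eq_zero_left this.symm
    have hb : ∀ x, β x = -α (α x) := fun x => by rw [← h2, hneg]
    have hba : β a = -a := by
      have := h0 0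
      rwa [hα, zero_add, zero_sub] at this
    have hbα : ∀ y, β (α y) = y := by
      intro y
      have h := h0 y
      have : β (α y + a) = β (α y) + β a := by
        simp only [hb, hadd]; abel
      rw [this, hba, ← sub_eq_add_neg] at h
      exact sub_left_injective h
    refine ⟨hadd, ?_, ?_, ?_⟩
    · exact eq_inv_of_mul_eq_one_left (Equiv.ext hbα)
    · intro x
      have h := hbα x
      rw [hb] at h
      rw [← h, neg_neg, h]
    · obtain ⟨z, hz⟩ := α.surjective (-a)
      have h := h0 z
      rw [hz, neg_add_cancel, hβ] at h
      rwa [← sub_eq_zero.mp h.symm, sub_eq_zero.mp h.symm] at hz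
  · rintro ⟨hadd, rfl, h3, ha⟩ x y
    apply α.injective
    apply α.injective
    have hi : ∀ z, α (α⁻¹ z) = z := fun z => α.apply_symm_apply z
    simp only [hadd, hi, h3, ha]
    have hneg : α (-a) = a := by
      have := hadd (-a) a
      rw [neg_add_cancel, hα, ha, ← sub_eq_add_neg] at this
      exact (sub_eq_zero.mp this.symm)
    rw [hneg]
    abel
end

section
/- Let (Q,+) be a group and let α, β, γ be permutations of Q. Then (α, β, γ) is an autotopism of (Q,+), i.e., α(x) + β(y) = γ(x + y) for all x, y ∈ Q, if and only if there exist an automorphism θ of (Q,+) and elements b, c ∈ Q such that α(x) = c + θ(x) + (-b), β(x) = b + θ(x), and γ(x) = c + θ(x) for all x ∈ Q. -/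
/-- A triple `(α, β, γ)` of permutations of `Q` is an autotopism of a group
`(Q,+)` iff there are an automorphism `θ` and elements `b, c` with
`α = L_c ∘ R_{-b} ∘ θ`, `β = L_b ∘ θ`, `γ = L_c ∘ θ`. -/
theorem group_autotopism_iff {Q : Type*} [AddGroup Q]
    (α β γ : Equiv.Perm Q) :
    (∀ x y : Q, α x + β y = γ (x + y)) ↔
      ∃ (θ : AddAut Q) (b c : Q),
        (∀ x : Q, α x = c + θ x + (-b)) ∧
        (∀ x : Q, β x = b + θ x) ∧
        (∀ x : Q, γ x = c + θ x) := by
  constructor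
  · intro h
    have hc : α 0 + β 0 = γ 0 := by simpa using h 0 0
    have hg : ∀ x, γ x = γ 0 + (-β 0 + β x) := by
      intro x
      have h1 := h 0 x
      rw [zero_add] at h1
      rw [← h1, ← hc, add_assoc, add_neg_cancel_left]
    have ha : ∀ x, α x = γ 0 + (-β 0 + β x) + (-β 0) := by
      intro x
      have h1 := h x 0
      rw [add_zero] at h1
      rw [← hg x, ← h1, add_neg_cancel_right]
    have hadd : ∀ x y, -β 0 + β (x + y) = (-β 0 + β x) + (-β 0 + β y) := by
      intro x y
      have h1 := h x y
      rw [hg (x + y), ha x, add_assoc, add_assoc] at h1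
      have h2 := add_left_cancel h1
      exact h2.symm
    let θ : AddAut Q :=
      { toEquiv := β.trans (Equiv.addLeft (-β 0))
        map_add' := hadd }
    have hθ : ∀ x, θ x = -β 0 + β x := fun x => rfl
    refine ⟨θ, β 0, γ 0, fun x => ?_, fun x => ?_, fun x => ?_⟩
    · rw [hθ]; exact ha x
    · rw [hθ, add_neg_cancel_left]
    · rw [hθ]; exact hg x
  · rintro ⟨θ, b, c, ha, hb, hg⟩ x y
    rw [ha, hb, hg, map_add]
    simp [add_assoc]
end

section
/- Let (Q,+) be a group with neutral element 0, let α be a permutation of Q with α(0) = 0, and let β₁, β₂, β₃, β₄ be permutations of Q. (1) If α(β₁(x) + β₂(y)) = β₃(x) + β₄(y) holds for all x, y ∈ Q, then α is an automorphism of (Q,+). (2) If α(β₁(x) + β₂(y)) = β₃(y) + β₄(x) holds for all x, y ∈ Q, then α is an anti-automorphism of (Q,+), i.e., α(u+v) = α(v) + α(u) for all u, v ∈ Q. -/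
/-- Let `α` be a unitary permutation of a group `(Q,+)` and `β₁,…,β₄`
permutations of `Q`. If `α (β₁ x + β₂ y) = β₃ x + β₄ y` for all `x, y`, then
`α` is an automorphism; if `α (β₁ x + β₂ y) = β₃ y + β₄ x` for all `x, y`,
then `α` is an anti-automorphism. -/
theorem unitary_perm_automorphism_or_antiautomorphism {Q : Type*} [AddGroup Q]
    (α : Equiv.Perm Q) (hα : α 0 = 0) (β₁ β₂ β₃ β₄ : Equiv.Perm Q) :
    ((∀ x y : Q, α (β₁ x + β₂ y) = β₃ x + β₄ y) →
      ∀ u v : Q, α (u + v) = α u + α v) ∧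
    ((∀ x y : Q, α (β₁ x + β₂ y) = β₃ y + β₄ x) →
      ∀ u v : Q, α (u + v) = α v + α u) := by
  have key : ∀ (a b c d : Q), b + c = 0 → a + d = (a + b) + (c + d) := by
    intro a b c d h
    rw [add_assoc, ← add_assoc b c d, h, zero_add]
  refine ⟨fun h u v => ?_, fun h u v => ?_⟩
  · have H : ∀ u v, α (u + v) = β₃ (β₁.symm u) + β₄ (β₂.symm v) := by
      intro u v
      simpa using h (β₁.symm u) (β₂.symm v)
    have h0 := H 0 0
    have hu := H u 0
    have hv := H 0 v
    rw [add_zero] at h0 hu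
    rw [zero_add] at hv
    rw [hα] at h0
    rw [H u v, hu, hv]
    exact key _ _ _ _ (add_eq_zero_iff_eq_neg.2 (neg_eq_of_add_eq_zero_right h0.symm).symm)
  · have H : ∀ u v, α (u + v) = β₃ (β₂.symm v) + β₄ (β₁.symm u) := by
      intro u v
      simpa using h (β₁.symm u) (β₂.symm v)
    have h0 := H 0 0
    have hu := H u 0
    have hv := H 0 v
    rw [add_zero] at h0 hu
    rw [zero_add] at hv
    rw [hα] at h0
    rw [H u v, hu, hv]
    exact key _ _ _ _ (add_eq_zero_iff_eq_neg.2 (neg_eq_of_add_eq_zero_right h0.symm).symm)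
end

section
/- Let m be a positive integer, let α and β be invertible elements of the ring ℤ_m of integers modulo m, let d ∈ ℤ_m, and define the operation x∘y = α·x + β·y + d on ℤ_m. Then (∘) is semi-symmetric (x∘(y∘x) = y for all x, y ∈ ℤ_m) if and only if β = α⁻¹, α³ = -1, and α·d = -d. -/
/-- A linear isotope `x∘y = α·x + β·y + d` of the cyclic group `ℤ_m` is
semi-symmetric iff `β = α⁻¹`, `α³ = -1` and `α·d = -d`. -/
theorem zmod_linear_isotope_semi_symmetric_iff (m : ℕ) (hm : 0 < m)
    (α β : (ZMod m)ˣ) (d : ZMod m)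
    (mul : ZMod m → ZMod m → ZMod m)
    (hmul : ∀ x y, mul x y = (α : ZMod m) * x + (β : ZMod m) * y + d) :
    (∀ x y, mul x (mul y x) = y) ↔
      (β = α⁻¹ ∧ (α : ZMod m) ^ 3 = -1 ∧ (α : ZMod m) * d = -d) := by
  have key : β = α⁻¹ ↔ (α : ZMod m) * (β : ZMod m) = 1 := by
    rw [eq_inv_iff_mul_eq_one, mul_comm, Units.ext_iff]
    simp
  rw [key]
  simp only [hmul]
  generalize (α : ZMod m) = a
  generalize (β : ZMod m) = b
  constructor
  · intro h
    have h0 := h 0 0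
    have h1 := h 1 0
    have h2 := h 0 1
    have e0 : b * d + d = 0 := by linear_combination h0
    have e1 : a + b ^ 2 = 0 := by linear_combination h1 - h0
    have e2 : a * b = 1 := by linear_combination h2 - h0
    refine ⟨e2, ?_, ?_⟩
    · linear_combination a ^ 2 * e1 - (a * b + 1) * e2
    · linear_combination a * e0 - d * e2
  · rintro ⟨e2, e3, e4⟩ x y
    have e0 : b * d + d = 0 := by linear_combination b * e4 - d * e2
    have e1 : a + b ^ 2 = 0 := by
      linear_combination b ^ 2 * e3 - a * (a * b + 1) * e2
    linear_combination x * e1 + y * e2 + e0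
end

section
/- Every quasigroup of order 3 is isomorphic to exactly one of the following five quasigroups on ℤ₃: x∘y = x + y; x∘y = x + 2y; x∘y = 2x + y; x∘y = 2x + 2y; x∘y = 2x + 2y + 1. That is, for every binary operation (·) on a 3-element set Q whose left and right translations are all bijective, there is exactly one operation (∘) from this list for which there exists a bijection φ : Q → ℤ₃ with φ(x·y) = φ(x) ∘ φ(y) for all x, y ∈ Q. -/
/-- The five pairwise non-isomorphic quasigroups of order 3 on `ℤ₃`:
`x+y`, `x+2y`, `2x+y`, `2x+2y`, `2x+2y+1`. -/
def orderThreeOps : Fin 5 → ZMod 3 → ZMod 3 → ZMod 3 :=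
  ![fun x y => x + y,
    fun x y => x + 2 * y,
    fun x y => 2 * x + y,
    fun x y => 2 * x + 2 * y,
    fun x y => 2 * x + 2 * y + 1]

set_option maxRecDepth 100000 in
set_option maxHeartbeats 4000000 in
set_option synthInstance.maxHeartbeats 2000000 in
set_option synthInstance.maxSize 100000 in
lemma aux_affine : ∀ a b : ZMod 3, a ≠ b → ∀ c, a ≠ c → b ≠ c → ∀ d, a ≠ d → ∀ e, b ≠ e → d ≠ e →
    ∀ f, c ≠ f → d ≠ f → e ≠ f → ∀ g, a ≠ g → d ≠ g → ∀ h, b ≠ h → e ≠ h → g ≠ h →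
    ∀ k, c ≠ k → f ≠ k → g ≠ k → h ≠ k →
    c = a + (b - a) * 2 ∧ e = d + b - a ∧ f = d + (b - a) * 2 ∧ g = a + (d - a) * 2 ∧
      h = g + b - a ∧ k = g + (b - a) * 2 := by
  decide

lemma aux_exists : ∀ a b c : ZMod 3, a ≠ 0 → b ≠ 0 → ∃ i : Fin 5, ∃ u t : ZMod 3, u ≠ 0 ∧
    ∀ x y, u * (a * x + b * y + c) + t = orderThreeOps i (u * x + t) (u * y + t) := by
  decide

lemma aux_inv : ∀ u : ZMod 3, u ≠ 0 → u * u = 1 := by decide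

set_option maxRecDepth 100000 in
set_option maxHeartbeats 4000000 in
set_option synthInstance.maxHeartbeats 2000000 in
set_option synthInstance.maxSize 100000 in
lemma aux_uniq : ∀ i j : Fin 5, ∀ a b : ZMod 3, a ≠ b → ∀ c, a ≠ c → b ≠ c →
    (∀ x y : ZMod 3, (![a, b, c] : ZMod 3 → ZMod 3) (orderThreeOps i x y)
      = orderThreeOps j ((![a, b, c] : ZMod 3 → ZMod 3) x) ((![a, b, c] : ZMod 3 → ZMod 3) y)) →
    i = j := by
  decide

lemma aux_form (f : ZMod 3 → ZMod 3 → ZMod 3) (hl : ∀ a, Function.Injective (f a))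
    (hr : ∀ a, Function.Injective (fun x => f x a)) :
    ∃ a b c : ZMod 3, a ≠ 0 ∧ b ≠ 0 ∧ ∀ x y, f x y = a * x + b * y + c := by
  have L : ∀ a x y, x ≠ y → f a x ≠ f a y := fun a x y h h' => h (hl a h')
  have R : ∀ a x y, x ≠ y → f x a ≠ f y a := fun a x y h h' => h (hr a h')
  have h01 : (0 : ZMod 3) ≠ 1 := by decide
  have h02 : (0 : ZMod 3) ≠ 2 := by decide
  have h12 : (1 : ZMod 3) ≠ 2 := by decide
  obtain ⟨h1, h2, h3, h4, h5, h6⟩ := aux_affine (f 0 0) (f 0 1) (L _ _ _ h01) (f 0 2) (L _ _ _ h02)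
    (L _ _ _ h12) (f 1 0) (R _ _ _ h01) (f 1 1) (R _ _ _ h01) (L _ _ _ h01) (f 1 2) (R _ _ _ h01)
    (L _ _ _ h02) (L _ _ _ h12) (f 2 0) (R _ _ _ h02) (R _ _ _ h12) (f 2 1) (R _ _ _ h02)
    (R _ _ _ h12) (L _ _ _ h01) (f 2 2) (R _ _ _ h02) (R _ _ _ h12) (L _ _ _ h02) (L _ _ _ h12)
  refine ⟨f 1 0 - f 0 0, f 0 1 - f 0 0, f 0 0, sub_ne_zero.2 (R _ _ _ h01).symm,
    sub_ne_zero.2 (L _ _ _ h01).symm, ?_⟩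
  have key : ∀ x : ZMod 3, x = 0 ∨ x = 1 ∨ x = 2 := by decide
  intro x y
  rcases key x with rfl | rfl | rfl <;> rcases key y with rfl | rfl | rfl
  · ring
  · ring
  · rw [h1]; ring
  · ring
  · rw [h2]; ring
  · rw [h3]; ring
  · rw [h4]; ring
  · rw [h5, h4]; ring
  · rw [h6, h4]; ring

/-- Every quasigroup of order 3 is isomorphic to exactly one of the five
quasigroups `x+y`, `x+2y`, `2x+y`, `2x+2y`, `2x+2y+1` on `ℤ₃`. -/
theorem order_three_quasigroup_classification {Q : Type*} [Fintype Q]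
    (hcard : Fintype.card Q = 3)
    (m : Q → Q → Q)
    (hl : ∀ a : Q, Function.Bijective (fun x => m a x))
    (hr : ∀ a : Q, Function.Bijective (fun x => m x a)) :
    ∃! i : Fin 5, ∃ φ : Q ≃ ZMod 3,
      ∀ x y, φ (m x y) = orderThreeOps i (φ x) (φ y) := by
  classical
  have e : Q ≃ ZMod 3 := Fintype.equivOfCardEq (by rw [hcard, ZMod.card])
  obtain ⟨a, b, c, ha, hb, hf⟩ := aux_form (fun x y => e (m (e.symm x) (e.symm y)))
    (fun a x y h => e.symm.injective ((hl (e.symm a)).1 (e.injective h)))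
    (fun a x y h => e.symm.injective ((hr (e.symm a)).1 (e.injective h)))
  obtain ⟨i, u, t, hu, hi⟩ := aux_exists a b c ha hb
  have huu := aux_inv u hu
  let s : ZMod 3 ≃ ZMod 3 :=
    { toFun := fun x => u * x + t
      invFun := fun x => u * (x - t)
      left_inv := fun x => by linear_combination x * huu
      right_inv := fun x => by linear_combination (x - t) * huu }
  have hφ : ∀ x y, (e.trans s) (m x y) = orderThreeOps i ((e.trans s) x) ((e.trans s) y) := by
    intro x y
    have h := hf (e x) (e y)
    simp only [Equiv.symm_apply_apply] at h
    change u * e (m x y) + t = orderThreeOps i (u * e x + t) (u * e y + t)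
    rw [h, hi]
  refine ⟨i, ⟨e.trans s, hφ⟩, ?_⟩
  rintro j ⟨ψ, hψ⟩
  generalize e.trans s = φ at hφ
  let σ : ZMod 3 ≃ ZMod 3 := φ.symm.trans ψ
  have hσ : ∀ x y, σ (orderThreeOps i x y) = orderThreeOps j (σ x) (σ y) := by
    intro x y
    have h := hφ (φ.symm x) (φ.symm y)
    simp only [Equiv.apply_symm_apply] at h
    change ψ (φ.symm _) = _
    rw [← h, Equiv.symm_apply_apply, hψ]
    rfl
  have hs : (![σ 0, σ 1, σ 2] : ZMod 3 → ZMod 3) = σ := by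
    funext x
    change Fin 3 at x
    fin_cases x <;> rfl
  refine (aux_uniq i j (σ 0) (σ 1) (σ.injective.ne (by decide)) (σ 2) (σ.injective.ne (by decide))
    (σ.injective.ne (by decide)) ?_).symm
  rw [hs]
  exact hσ
end

section
/- Let p be a prime, let α and β be invertible elements of ℤ_p, and let d ∈ ℤ_p. Denote by (α,β,d) the quasigroup operation x∘y = α·x + β·y + d on ℤ_p. If α + β ≠ 1, then (α,β,d) is isomorphic to (α,β,0), i.e., there is a bijection φ : ℤ_p → ℤ_p with φ(α·x + β·y + d) = α·φ(x) + β·φ(y) for all x, y. If α + β = 1, then (α,β,d) is isomorphic to (α,β,0) or to (α,β,1). -/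
/-- For a prime `p`, the linear isotope `(α,β,d)` of `ℤ_p` is isomorphic to
`(α,β,0)` when `α + β ≠ 1`, and is isomorphic to `(α,β,0)` or `(α,β,1)` when
`α + β = 1`. -/
theorem zmod_linear_isotope_free_member (p : ℕ) (hp : p.Prime)
    (α β : (ZMod p)ˣ) (d : ZMod p) :
    ((α : ZMod p) + (β : ZMod p) ≠ 1 →
      ∃ φ : ZMod p ≃ ZMod p, ∀ x y : ZMod p,
        φ ((α : ZMod p) * x + (β : ZMod p) * y + d) =
          (α : ZMod p) * φ x + (β : ZMod p) * φ y) ∧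
    ((α : ZMod p) + (β : ZMod p) = 1 →
      ((∃ φ : ZMod p ≃ ZMod p, ∀ x y : ZMod p,
          φ ((α : ZMod p) * x + (β : ZMod p) * y + d) =
            (α : ZMod p) * φ x + (β : ZMod p) * φ y) ∨
       (∃ φ : ZMod p ≃ ZMod p, ∀ x y : ZMod p,
          φ ((α : ZMod p) * x + (β : ZMod p) * y + d) =
            (α : ZMod p) * φ x + (β : ZMod p) * φ y + 1))) := by
  have : Fact p.Prime := ⟨hp⟩
  refine ⟨fun h => ?_, fun _ => ?_⟩
  · have h' : (α : ZMod p) + (β : ZMod p) - 1 ≠ 0 := sub_ne_zero.mpr h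
    refine ⟨Equiv.addRight (d * ((α : ZMod p) + (β : ZMod p) - 1)⁻¹), fun x y => ?_⟩
    have hc := mul_inv_cancel₀ h'
    simp only [Equiv.coe_addRight]
    linear_combination (-d) * hc
  · by_cases hd : d = 0
    · exact Or.inl ⟨Equiv.refl _, fun x y => by simp [hd]⟩
    · refine Or.inr ⟨Equiv.mulLeft₀ d⁻¹ (inv_ne_zero hd), fun x y => ?_⟩
      have hc := mul_inv_cancel₀ hd
      change d⁻¹ * _ = _ * (d⁻¹ * x) + _ * (d⁻¹ * y) + 1
      linear_combination hc
end

section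
/- Let p be a prime. Consider the set of all operations on ℤ_p of the form x∘y = α·x + β·y + d with α, β invertible elements of ℤ_p and d ∈ ℤ_p, up to isomorphism (where two operations (∘), (∗) are identified when there exists a bijection φ of ℤ_p with φ(x∘y) = φ(x) ∗ φ(y) for all x, y). The number of isomorphism classes is exactly p² - p - 1. -/
lemma li_key {p : ℕ} [Fact p.Prime] (a b d a' b' d' : ZMod p) (ha : a ≠ 0) (hb : b ≠ 0)
    (φ : ZMod p ≃ ZMod p)
    (h : ∀ x y, φ (a * x + b * y + d) = a' * φ x + b' * φ y + d') :
    a = a' ∧ b = b' ∧ (a + b = 1 → d = 0 → d' = 0) := by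
  have h1 : ∀ x y, φ (x + y) = (a' * φ (a⁻¹ * x)) + (b' * φ (b⁻¹ * (y - d)) + d') := by
    intro x y
    rw [← add_assoc, ← h]
    congr 1
    field_simp
    ring
  have h2 : ∀ x y, φ (x + y) - φ 0 = (φ x - φ 0) + (φ y - φ 0) := by
    intro x y
    have e1 := h1 x y
    have e2 := h1 x 0
    have e3 := h1 0 y
    have e4 := h1 0 0
    simp only [add_zero, zero_add] at e1 e2 e3 e4
    linear_combination e1 - e2 - e3 + e4
  let ψ : ZMod p →+ ZMod p := AddMonoidHom.mk' (fun x => φ x - φ 0) h2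
  have h3 : ∀ x, φ x = x * (φ 1 - φ 0) + φ 0 := by
    intro x
    have := ZMod.map_smul ψ x 1
    simp only [smul_eq_mul, mul_one] at this
    have h4 : φ x - φ 0 = x * (φ 1 - φ 0) := this
    linear_combination h4
  have hc : φ 1 - φ 0 ≠ 0 := by
    intro h0
    exact one_ne_zero (φ.injective (sub_eq_zero.mp h0))
  generalize φ 1 - φ 0 = c at h3 hc
  generalize φ 0 = e at h3
  have h4 : ∀ x y, (a * x + b * y + d) * c + e = a' * (x * c + e) + b' * (y * c + e) + d' := by
    intro x y
    rw [← h3, ← h3, ← h3, h]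
  have e1 := h4 0 0
  have e2 := h4 1 0
  have e3 := h4 0 1
  have ea : a = a' := mul_right_cancel₀ hc (by linear_combination e2 - e1)
  have eb : b = b' := mul_right_cancel₀ hc (by linear_combination e3 - e1)
  refine ⟨ea, eb, fun hs hd => ?_⟩
  subst ea eb hd
  linear_combination -e1 - e * hs

/-- For a prime `p`, there are exactly `p² - p - 1` linear isotopes of the
cyclic group of order `p` up to isomorphism. -/
theorem card_zmod_linear_isotopes_up_to_iso (p : ℕ) (hp : p.Prime) :
    Nat.card (Quot (fun (f g : {f : ZMod p → ZMod p → ZMod p //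
        ∃ (α β : (ZMod p)ˣ) (d : ZMod p), ∀ x y,
          f x y = (α : ZMod p) * x + (β : ZMod p) * y + d}) =>
      ∃ φ : ZMod p ≃ ZMod p, ∀ x y, φ (f.1 x y) = g.1 (φ x) (φ y))) =
      p ^ 2 - p - 1 := by
  haveI : Fact p.Prime := ⟨hp⟩
  set X := {f : ZMod p → ZMod p → ZMod p //
        ∃ (α β : (ZMod p)ˣ) (d : ZMod p), ∀ x y,
          f x y = (α : ZMod p) * x + (β : ZMod p) * y + d} with hX
  set r : X → X → Prop := fun f g =>
      ∃ φ : ZMod p ≃ ZMod p, ∀ x y, φ (f.1 x y) = g.1 (φ x) (φ y) with hr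
  have hequiv : Equivalence r := by
    refine ⟨fun f => ⟨Equiv.refl _, fun x y => rfl⟩, ?_, ?_⟩
    · rintro f g ⟨φ, h⟩
      refine ⟨φ.symm, fun x y => ?_⟩
      rw [Equiv.symm_apply_eq, h]
      simp
    · rintro f g k ⟨φ, h⟩ ⟨χ, h'⟩
      exact ⟨φ.trans χ, fun x y => by simp [h, h']⟩
  have hex : ∀ f g : X, Quot.mk r f = Quot.mk r g → r f g := fun f g h =>
    (hequiv.eqvGen_iff).1 (Quot.eqvGen_exact h)
  let op : (ZMod p)ˣ → (ZMod p)ˣ → ZMod p → X := fun a b d =>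
    ⟨fun x y => (a : ZMod p) * x + (b : ZMod p) * y + d, a, b, d, fun x y => rfl⟩
  have key : ∀ a b d a' b' d', r (op a b d) (op a' b' d') →
      a = a' ∧ b = b' ∧ ((a : ZMod p) + b = 1 → d = 0 → d' = 0) := by
    rintro a b d a' b' d' ⟨φ, h⟩
    obtain ⟨h1, h2, h3⟩ := li_key (a : ZMod p) b d a' b' d' a.ne_zero b.ne_zero φ h
    exact ⟨Units.ext h1, Units.ext h2, h3⟩
  have hu : ∀ u : {u : (ZMod p)ˣ // u ≠ 1}, (1 : ZMod p) - (u.1 : ZMod p) ≠ 0 := by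
    rintro ⟨u, hu⟩ h
    exact hu (Units.ext (sub_eq_zero.mp h).symm)
  let F : ((ZMod p)ˣ × (ZMod p)ˣ) ⊕ {u : (ZMod p)ˣ // u ≠ 1} → Quot r := fun s =>
    match s with
    | Sum.inl t => Quot.mk r (op t.1 t.2 0)
    | Sum.inr u => Quot.mk r (op u.1 (Units.mk0 _ (hu u)) 1)
  have hF : Function.Bijective F := by
    constructor
    · rintro (⟨a, b⟩ | u) (⟨a', b'⟩ | v) h
      · obtain ⟨h1, h2, -⟩ := key _ _ _ _ _ _ (hex _ _ h)
        simp only at h1 h2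
        rw [h1, h2]
      · obtain ⟨h1, h2, h3⟩ := key _ _ _ _ _ _ (hex _ _ h)
        dsimp only at h1 h2
        exact absurd (h3 (by rw [h1, h2]; simp) rfl) one_ne_zero
      · obtain ⟨h1, h2, h3⟩ := key _ _ _ _ _ _ (hequiv.symm (hex _ _ h))
        dsimp only at h1 h2
        exact absurd (h3 (by rw [h1, h2]; simp) rfl) one_ne_zero
      · obtain ⟨h1, -, -⟩ := key _ _ _ _ _ _ (hex _ _ h)
        rw [Subtype.ext h1]
    · intro q
      induction q using Quot.ind with
      | mk f =>
        obtain ⟨f, a, b, d, hf⟩ := f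
        by_cases hs : (a : ZMod p) + b = 1
        · by_cases hd : d = 0
          · refine ⟨Sum.inl (a, b), Quot.sound ⟨Equiv.refl _, fun x y => ?_⟩⟩
            simp [op, hf, hd]
          · have ha : a ≠ 1 := by
              rintro rfl
              apply b.ne_zero
              simpa using hs
            refine ⟨Sum.inr ⟨a, ha⟩, Quot.sound ⟨Equiv.mulLeft₀ d hd, fun x y => ?_⟩⟩
            simp only [op, hf, Equiv.mulLeft₀_apply, Units.val_mk0]
            linear_combination (-d * y) * hs
        · have hs' : (1 : ZMod p) - a - b ≠ 0 := by
            intro h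
            apply hs
            linear_combination -h
          refine ⟨Sum.inl (a, b), Quot.sound
            ⟨Equiv.addRight (d * (1 - (a : ZMod p) - b)⁻¹), fun x y => ?_⟩⟩
          simp only [op, hf, Equiv.coe_addRight]
          linear_combination d * mul_inv_cancel₀ hs'
  rw [← Nat.card_congr (Equiv.ofBijective F hF), Nat.card_eq_fintype_card]
  rw [Fintype.card_sum, Fintype.card_prod, Fintype.card_subtype_compl, Fintype.card_subtype_eq,
    ZMod.card_units]
  obtain ⟨k, rfl⟩ := Nat.exists_eq_add_of_le hp.two_le
  have e : (2 + k) ^ 2 = (k + 1) * (k + 1) + k + (2 + k) + 1 := by ring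
  rw [e]
  have e2 : 2 + k - 1 = k + 1 := by omega
  rw [e2]
  omega
end

section
/- Let (Q,·) be a group isotope, i.e., there exist a group structure on Q and bijections making x·y = γ⁻¹(α(x) + β(y)). Then for every element e ∈ Q there exist a group operation + on Q with neutral element e, permutations α, β of Q with α(e) = e and β(e) = e, and an element a ∈ Q, such that x·y = α(x) + a + β(y) for all x, y ∈ Q; moreover this canonical decomposition is unique: the group operation +, the permutations α, β, and the element a are uniquely determined by (Q,·) and e. -/
theorem gi_key {Q : Type*} [AddGroup Q] (mul : Q → Q → Q) (A B : Q ≃ Q) (a : Q)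
    (hA : A 0 = 0) (hB : B 0 = 0) (h : ∀ x y, mul x y = A x + a + B y)
    (x y p q r s t k : Q) (h1 : mul p 0 = x) (h2 : mul 0 k = 0) (h3 : mul s k = mul 0 0)
    (h4 : mul 0 q = mul s 0) (h5 : mul r 0 = mul p q) (h6 : mul 0 t = y) :
    x + y = mul r t := by
  simp only [h, hA, hB, zero_add, add_zero] at *
  have hk : B k = -a := (neg_eq_of_add_eq_zero_right h2).symm
  have hs : A s = a := by
    rw [hk] at h3; simpa using h3
  rw [hs] at h4
  have hq : B q = a := add_left_cancel h4
  rw [hq, ] at h5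
  have hr : A r = A p + a := add_right_cancel h5
  rw [hr, ← h1, ← h6]; simp [add_assoc]

theorem gi_ex {Q : Type*} [AddGroup Q] (mul : Q → Q → Q) (A B : Q ≃ Q) (a : Q)
    (h : ∀ x y, mul x y = A x + a + B y) (u v : Q) :
    (∃ p, mul p u = v) ∧ (∃ p, mul u p = v) := by
  refine ⟨⟨A.symm (v - B u - a), by simp [h]⟩, ⟨B.symm (-(A u + a) + v), by simp [h, add_assoc]⟩⟩

theorem gi_inst {Q : Type*} (add : Q → Q → Q) (e : Q)
    (h1 : ∀ x y z, add (add x y) z = add x (add y z)) (h2 : ∀ x, add e x = x)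
    (h4 : ∀ x, ∃ y, add x y = e ∧ add y x = e) :
    ∃ I : AddGroup Q, (∀ x y, add x y = x + y) ∧ e = 0 := by
  choose n hn using h4
  letI : Add Q := ⟨add⟩
  letI : Neg Q := ⟨n⟩
  letI : Zero Q := ⟨e⟩
  exact ⟨AddGroup.ofLeftAxioms h1 h2 (fun x => (hn x).2), fun _ _ => rfl, rfl⟩

theorem gi_raw {Q : Type*} (mul : Q → Q → Q) (e : Q) (add : Q → Q → Q) (A B : Q ≃ Q) (a : Q)
    (h1 : ∀ x y z, add (add x y) z = add x (add y z)) (h2 : ∀ x, add e x = x)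
    (h4 : ∀ x, ∃ y, add x y = e ∧ add y x = e) (hA : A e = e) (hB : B e = e)
    (h : ∀ x y, mul x y = add (add (A x) a) (B y)) :
    (∀ x y p q r s t k : Q, mul p e = x → mul e k = e → mul s k = mul e e →
      mul e q = mul s e → mul r e = mul p q → mul e t = y → add x y = mul r t) ∧
    (∀ u v, (∃ p, mul p u = v) ∧ (∃ p, mul u p = v)) ∧
    (∀ x y z, add x z = add y z → x = y) ∧ (∀ x y z, add z x = add z y → x = y) := by
  obtain ⟨I, hI, rfl⟩ := gi_inst add e h1 h2 h4
  simp only [hI] at *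
  exact ⟨gi_key mul A B a hA hB h, gi_ex mul A B a h,
    fun _ _ _ => add_right_cancel, fun _ _ _ => add_left_cancel⟩


/-- Every element `e` of a group isotope `(Q,·)` uniquely determines a
canonical decomposition `x·y = α x + a + β y`, where `+` is a group operation
on `Q` with neutral element `e` and `α, β` are permutations of `Q` fixing `e`.
The tuple `dec = (add, α, β, a)` encodes the decomposition. -/
theorem group_isotope_canonical_decomposition {Q : Type*} (mul : Q → Q → Q)
    (hiso : ∃ _inst : AddGroup Q, ∃ α β γ : Q ≃ Q,
      ∀ x y, mul x y = γ.symm (α x + β y))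
    (e : Q) :
    ∃! dec : (Q → Q → Q) × (Q ≃ Q) × (Q ≃ Q) × Q,
      (∀ x y z, dec.1 (dec.1 x y) z = dec.1 x (dec.1 y z)) ∧
      (∀ x, dec.1 e x = x) ∧
      (∀ x, dec.1 x e = x) ∧
      (∀ x, ∃ y, dec.1 x y = e ∧ dec.1 y x = e) ∧
      dec.2.1 e = e ∧
      dec.2.2.1 e = e ∧
      (∀ x y, mul x y = dec.1 (dec.1 (dec.2.1 x) dec.2.2.2) (dec.2.2.1 y)) := by

  obtain ⟨I, α, β, γ, hm⟩ := hiso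
  apply existsUnique_of_exists_of_unique
  · refine ⟨⟨fun x y => γ.symm (γ x - γ e + γ y),
      (α.trans (Equiv.addRight (-α e + γ e))).trans γ.symm,
      (β.trans (Equiv.addLeft (γ e - β e))).trans γ.symm, mul e e⟩, ?_, ?_, ?_, ?_, ?_, ?_, ?_⟩
    · intro x y z; simp [sub_eq_add_neg, add_assoc]
    · intro x; simp
    · intro x; simp
    · intro x
      exact ⟨γ.symm (γ e - γ x + γ e), by simp [sub_eq_add_neg, add_assoc],
        by simp [sub_eq_add_neg, add_assoc]⟩
    · simp
    · simp
    · intro x y; simp [hm, sub_eq_add_neg, add_assoc]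
  · rintro ⟨f, A, B, a⟩ ⟨g, C, D, c⟩ ⟨f1, f2, f3, f4, fA, fB, fm⟩ ⟨g1, g2, g3, g4, gA, gB, gm⟩
    dsimp only at *
    obtain ⟨k1, ex, cr, cl⟩ := gi_raw mul e f A B a f1 f2 f4 fA fB fm
    obtain ⟨k2, -, -, -⟩ := gi_raw mul e g C D c g1 g2 g4 gA gB gm
    have hfg : f = g := by
      funext x y
      obtain ⟨p, hp⟩ := (ex e x).1
      obtain ⟨k, hk⟩ := (ex e e).2
      obtain ⟨s, hs⟩ := (ex k (mul e e)).1
      obtain ⟨q, hq⟩ := (ex e (mul s e)).2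
      obtain ⟨r, hr⟩ := (ex e (mul p q)).1
      obtain ⟨t, ht⟩ := (ex e y).2
      rw [k1 x y p q r s t k hp hk hs hq hr ht, k2 x y p q r s t k hp hk hs hq hr ht]
    subst hfg
    have hac : a = c := by
      have := (fm e e).symm.trans (gm e e)
      simpa only [fA, fB, gA, gB, f2, f3] using this
    subst hac
    have hAC : A = C := by
      ext x
      have := (fm x e).symm.trans (gm x e)
      rw [fB, gB] at this
      exact cr _ _ _ (cr _ _ _ this)
    have hBD : B = D := by
      ext y
      have := (fm e y).symm.trans (gm e y)
      rw [fA, gA] at this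
      exact cl _ _ _ this
    rw [hAC, hBD]
end
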